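/- arXiv:2103.09997 — 2 statements merged into one kernel-verified Lean document; each statement's English description precedes it below -/
import Mathlib

section
/- Suppose (θ₀,…,θ₆) ∈ (T³)⁷ is such that among the seven first coordinates θ₀¹,…,θ₆¹ there are exactly 3 distinct values, occurring with multiplicities 4, 2, 1. Then |Θ(θ₀,…,θ₆)| ≤ 8/35. -/
open scoped BigOperators
open scoped Classical

noncomputable section

instance : Fact ((0:ℝ) < 1) := ⟨one_pos⟩

/-- The circle `ℝ/ℤ` with its standard circular order. -/
abbrev S1 : Type := AddCircle (1 : ℝ)

/-- The 3-torus `S¹ × S¹ × S¹`. -/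
abbrev T3 : Type := S1 × S1 × S1

/-- The orientation cocycle on the circle: `1` if `(a,b,c)` are pairwise distinct and
positively oriented, `-1` if pairwise distinct and negatively oriented, `0` otherwise. -/
noncomputable def OrS1 (a b c : S1) : ℝ :=
  if sbtw a b c then 1 else if sbtw c b a then -1 else 0

/-- The cocycle `Θ` on `(T³)⁷`. -/
noncomputable def Theta (θ : Fin 7 → T3) : ℝ :=
  (1 / (Nat.factorial 7 : ℝ)) * ∑ σ : Equiv.Perm (Fin 7),
    ((Equiv.Perm.sign σ : ℤ) : ℝ) *
      (OrS1 (θ (σ 0)).1 (θ (σ 1)).1 (θ (σ 2)).1 *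
       OrS1 (θ (σ 2)).2.1 (θ (σ 3)).2.1 (θ (σ 4)).2.1 *
       OrS1 (θ (σ 4)).2.2 (θ (σ 5)).2.2 (θ (σ 6)).2.2)

theorem abs_OrS1_le_one (a b c : S1) : |OrS1 a b c| ≤ 1 := by
  unfold OrS1
  split_ifs <;> simp

theorem OrS1_eq_zero_of_not_distinct {a b c : S1} (h : ¬(a ≠ b ∧ a ≠ c ∧ b ≠ c)) :
    OrS1 a b c = 0 := by
  have key : a = b ∨ a = c ∨ b = c := by tauto
  unfold OrS1
  rcases key with rfl | rfl | rfl
  · rw [if_neg sbtw_irrefl_left, if_neg sbtw_irrefl_right]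
  · rw [if_neg sbtw_irrefl_left_right, if_neg sbtw_irrefl_left_right]
  · rw [if_neg sbtw_irrefl_right, if_neg sbtw_irrefl_left]

/-- At most `4! = 24` permutations of `Fin 7` take prescribed values at `0, 1, 2`. -/
theorem card_perm_prescribed_le (t : Fin 7 × Fin 7 × Fin 7) (s : Finset (Equiv.Perm (Fin 7)))
    (hs : ∀ σ ∈ s, (σ 0, σ 1, σ 2) = t) : s.card ≤ 24 := by
  rcases s.eq_empty_or_nonempty with rfl | ⟨τ, hτ⟩
  · simp
  have hfix : ∀ σ ∈ s, ∀ i : Fin 7, ¬(2 < i) → (τ⁻¹ * σ) i = i := by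
    intro σ hσ i hi
    have h := (hs σ hσ).trans (hs τ hτ).symm
    simp only [Prod.mk.injEq] at h
    obtain ⟨h0, h1, h2⟩ := h
    rw [Equiv.Perm.mul_apply, Equiv.Perm.inv_eq_iff_eq]
    have hi' : i = 0 ∨ i = 1 ∨ i = 2 := by omega
    rcases hi' with rfl | rfl | rfl <;> assumption
  let f : s → {ρ : Equiv.Perm (Fin 7) // ∀ i, ¬(2 < i) → ρ i = i} :=
    fun σ => ⟨τ⁻¹ * σ.1, hfix σ.1 σ.2⟩
  have hf : Function.Injective f := fun σ σ' h =>
    Subtype.ext (mul_left_cancel (Subtype.ext_iff.mp h))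
  have hcard := Nat.card_le_card_of_injective f hf
  rw [Nat.card_congr (Equiv.Perm.subtypeEquivSubtypePerm fun i : Fin 7 => 2 < i).symm,
    Nat.card_perm, Nat.card_eq_fintype_card, Nat.card_eq_fintype_card, Fintype.card_coe] at hcard
  have h4 : Fintype.card {i : Fin 7 // 2 < i} = 4 := by
    rw [Fintype.card_subtype]
    rfl
  rwa [h4] at hcard

/-- The number of triples of indices whose values under a map with fibres of sizes `4, 2, 1`
are pairwise distinct is at most `48`. -/
theorem card_distinct_triples_le {α : Type*} (g : Fin 7 → α) (a b c : α)
    (hab : a ≠ b) (hac : a ≠ c) (hbc : b ≠ c)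
    (ha : ({j : Fin 7 | g j = a}).ncard = 4)
    (hb : ({j : Fin 7 | g j = b}).ncard = 2)
    (hc : ({j : Fin 7 | g j = c}).ncard = 1) :
    (Finset.univ.filter fun t : Fin 7 × Fin 7 × Fin 7 =>
      g t.1 ≠ g t.2.1 ∧ g t.1 ≠ g t.2.2 ∧ g t.2.1 ≠ g t.2.2).card ≤ 48 := by
  let F : α → Finset (Fin 7) := fun x => Finset.univ.filter fun j => g j = x
  have hF : ∀ x, (F x).card = ({j : Fin 7 | g j = x}).ncard := fun x => by
    rw [← Set.ncard_coe_finset]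
    simp [F]
  have mem_F : ∀ x j, j ∈ F x ↔ g j = x := fun x j => by simp [F]
  have hA : (F a).card = 4 := (hF a).trans ha
  have hB : (F b).card = 2 := (hF b).trans hb
  have hC : (F c).card = 1 := (hF c).trans hc
  have disj : ∀ x y, x ≠ y → Disjoint (F x) (F y) := fun x y hxy =>
    Finset.disjoint_left.mpr fun j hx hy => hxy (((mem_F x j).mp hx).symm.trans ((mem_F y j).mp hy))
  have hcover : F a ∪ F b ∪ F c = Finset.univ := by
    apply Finset.eq_univ_of_card
    rw [Finset.card_union_of_disjoint
        (Finset.disjoint_union_left.mpr ⟨disj a c hac, disj b c hbc⟩),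
      Finset.card_union_of_disjoint (disj a b hab), hA, hB, hC, Fintype.card_fin]
  have hval : ∀ j, g j = a ∨ g j = b ∨ g j = c := fun j => by
    have h : j ∈ F a ∪ F b ∪ F c := hcover ▸ Finset.mem_univ j
    simpa [mem_F, or_assoc] using h
  let P : α → α → α → Finset (Fin 7 × Fin 7 × Fin 7) := fun x y z => F x ×ˢ F y ×ˢ F z
  have hP : ∀ x y z, (P x y z).card = (F x).card * ((F y).card * (F z).card) := fun x y z => by
    simp [P, Finset.card_product]
  have hsub : (Finset.univ.filter fun t : Fin 7 × Fin 7 × Fin 7 =>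
      g t.1 ≠ g t.2.1 ∧ g t.1 ≠ g t.2.2 ∧ g t.2.1 ≠ g t.2.2) ⊆
      P a b c ∪ (P a c b ∪ (P b a c ∪ (P b c a ∪ (P c a b ∪ P c b a)))) := by
    rintro ⟨i, j, k⟩ h
    simp only [Finset.mem_filter, Finset.mem_univ, true_and] at h
    simp only [P, Finset.mem_union, Finset.mem_product, mem_F]
    have hi := hval i
    have hj := hval j
    have hk := hval k
    grind
  refine (Finset.card_le_card hsub).trans ?_
  have h1 := Finset.card_union_le (P a b c) (P a c b ∪ (P b a c ∪ (P b c a ∪ (P c a b ∪ P c b a))))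
  have h2 := Finset.card_union_le (P a c b) (P b a c ∪ (P b c a ∪ (P c a b ∪ P c b a)))
  have h3 := Finset.card_union_le (P b a c) (P b c a ∪ (P c a b ∪ P c b a))
  have h4 := Finset.card_union_le (P b c a) (P c a b ∪ P c b a)
  have h5 := Finset.card_union_le (P c a b) (P c b a)
  simp only [hP, hA, hB, hC] at h1 h2 h3 h4 h5
  omega

/-- `|Θ|` is at most the proportion of permutations whose first factor can be nonzero. -/
theorem abs_Theta_le_card (θ : Fin 7 → T3) :
    |Theta θ| ≤ (1 / (Nat.factorial 7 : ℝ)) * ((Finset.univ.filter fun σ : Equiv.Perm (Fin 7) =>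
      (θ (σ 0)).1 ≠ (θ (σ 1)).1 ∧ (θ (σ 0)).1 ≠ (θ (σ 2)).1 ∧
        (θ (σ 1)).1 ≠ (θ (σ 2)).1).card : ℝ) := by
  unfold Theta
  rw [abs_mul, abs_of_nonneg (by positivity : (0 : ℝ) ≤ 1 / (Nat.factorial 7 : ℝ)),
    Finset.card_filter, Nat.cast_sum]
  refine mul_le_mul_of_nonneg_left
    ((Finset.abs_sum_le_sum_abs _ _).trans (Finset.sum_le_sum fun σ _ => ?_)) (by positivity)
  have hsign : |((Equiv.Perm.sign σ : ℤ) : ℝ)| = 1 := by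
    rcases Int.units_eq_one_or (Equiv.Perm.sign σ) with h | h <;> simp [h]
  split_ifs with h
  · rw [abs_mul, hsign, one_mul, abs_mul, abs_mul, Nat.cast_one]
    exact mul_le_one₀ (mul_le_one₀ (abs_OrS1_le_one _ _ _) (abs_nonneg _) (abs_OrS1_le_one _ _ _))
      (abs_nonneg _) (abs_OrS1_le_one _ _ _)
  · rw [OrS1_eq_zero_of_not_distinct h]
    simp

/-- If the seven first coordinates take exactly 3 distinct values with multiplicities
`4, 2, 1`, then `|Θ(θ₀,…,θ₆)| ≤ 8/35`. -/
theorem abs_Theta_le_of_mult_421 (θ : Fin 7 → T3) (a b c : S1)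
    (hab : a ≠ b) (hac : a ≠ c) (hbc : b ≠ c)
    (ha : ({j : Fin 7 | (θ j).1 = a}).ncard = 4)
    (hb : ({j : Fin 7 | (θ j).1 = b}).ncard = 2)
    (hc : ({j : Fin 7 | (θ j).1 = c}).ncard = 1) :
    |Theta θ| ≤ 8 / 35 := by
  have hcount : (Finset.univ.filter fun σ : Equiv.Perm (Fin 7) =>
      (θ (σ 0)).1 ≠ (θ (σ 1)).1 ∧ (θ (σ 0)).1 ≠ (θ (σ 2)).1 ∧
        (θ (σ 1)).1 ≠ (θ (σ 2)).1).card ≤ 24 * 48 := by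
    refine (Finset.card_le_mul_card_image_of_maps_to
      (f := fun σ : Equiv.Perm (Fin 7) => (σ 0, σ 1, σ 2)) (fun σ hσ => ?_) 24
      (fun t _ => card_perm_prescribed_le t _ fun σ hσ => (Finset.mem_filter.mp hσ).2)).trans
      (Nat.mul_le_mul_left 24
        (card_distinct_triples_le (fun j => (θ j).1) a b c hab hac hbc ha hb hc))
    simpa using hσ
  refine (abs_Theta_le_card θ).trans ?_
  calc _ ≤ (1 / (Nat.factorial 7 : ℝ)) * ((24 * 48 : ℕ) : ℝ) :=
        mul_le_mul_of_nonneg_left (Nat.cast_le.mpr hcount) (by positivity)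
    _ = 8 / 35 := by norm_num [Nat.factorial]
end
end

section
/- Suppose (θ₀,…,θ₆) ∈ (T³)⁷ is such that among the seven first coordinates θ₀¹,…,θ₆¹ there are exactly 6 distinct values, occurring with multiplicities 2, 1, 1, 1, 1, 1. Then |Θ(θ₀,…,θ₆)| ≤ 2/9. -/
open scoped BigOperators
open scoped Classical

noncomputable section

/-- The sign of `y - x`: `1` if `x < y`, `-1` if `y < x` and `0` otherwise. -/
def cmpSign {α : Type*} [LT α] [DecidableLT α] (R : Type*) [Ring R] (x y : α) : R :=
  if x < y then 1 else if y < x then -1 else 0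

/-- The polarized Pfaffian on four indices of `c` and the matrix with all entries `1` above the
diagonal. -/
def pf4 {ι R : Type*} [Ring R] (c : ι → ι → R) (i j k l : ι) : R :=
  c i j - c i k + c i l + c j k - c j l + c k l

/-- The alternating sum of `v i` times the polarized Pfaffian of `c` on the indices other than `i`. -/
def minorPairing {R : Type*} [Ring R] (v : Fin 5 → R) (c : Fin 5 → Fin 5 → R) : R :=
  v 0 * pf4 c 1 2 3 4 - v 1 * pf4 c 0 2 3 4 + v 2 * pf4 c 0 1 3 4 - v 3 * pf4 c 0 1 2 4
    + v 4 * pf4 c 0 1 2 3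

/-- The sum of the absolute values of the five polarized Pfaffians of `c`. -/
def minorNorm (c : Fin 5 → Fin 5 → ℤ) : ℤ :=
  |pf4 c 1 2 3 4| + |pf4 c 0 2 3 4| + |pf4 c 0 1 3 4| + |pf4 c 0 1 2 4| + |pf4 c 0 1 2 3|

/-- The position, relative to five points ordered by `σ`, of a point lying above exactly `t` of
them: `1` for the points above it and `-1` for those below. -/
def threshold (R : Type*) [Ring R] (t : Fin 6) (σ : Equiv.Perm (Fin 5)) (i : Fin 5) : R :=
  if t ≤ (σ i).castSucc then 1 else -1

theorem minorPairing_check : ∀ σ : Equiv.Perm (Fin 5), minorNorm (fun i j => cmpSign ℤ (σ i) (σ j)) ≤ 10 ∨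
    ∀ τ : Equiv.Perm (Fin 5), minorNorm (fun i j => cmpSign ℤ (σ i) (σ j)) +
      minorNorm (fun i j => cmpSign ℤ (τ i) (τ j)) ≤ 20 ∨
      ∀ s t : Fin 6, |minorPairing (threshold ℤ s σ) (fun i j => cmpSign ℤ (τ i) (τ j)) +
        minorPairing (threshold ℤ t τ) (fun i j => cmpSign ℤ (σ i) (σ j))| ≤ 20 := by
  decide +kernel

theorem btw_coe_iff_of_abs_lt {u v w : ℝ} (h₁ : |v - u| < 1) (h₂ : |w - v| < 1)
    (h₃ : |u - w| < 1) :
    btw (u : S1) (v : S1) (w : S1) ↔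
      u = v ∨ v = w ∨ w = u ∨ u < v ∧ v < w ∨ v < w ∧ w < u ∨ w < u ∧ u < v := by
  rw [abs_lt] at h₁ h₂ h₃
  have e₂ : toIcoMod (zero_lt_one' ℝ) u v = if u ≤ v then v else v + 1 := by
    split_ifs with h
    · exact (toIcoMod_eq_self _).2 ⟨h, by linarith⟩
    · rw [← toIcoMod_add_right]
      exact (toIcoMod_eq_self _).2 ⟨by linarith, by linarith⟩
  have e₃ : toIocMod (zero_lt_one' ℝ) u w = if u < w then w else w + 1 := by
    split_ifs with h
    · exact (toIocMod_eq_self _).2 ⟨h, by linarith⟩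
    · rw [← toIocMod_add_right]
      exact (toIocMod_eq_self _).2 ⟨by linarith, by linarith⟩
  rw [QuotientAddGroup.btw_coe_iff, e₂, e₃]
  grind

theorem OrS1_coe {u v w : ℝ} (h₁ : |v - u| < 1) (h₂ : |w - v| < 1) (h₃ : |u - w| < 1) :
    OrS1 u v w = cmpSign ℝ u v + cmpSign ℝ v w + cmpSign ℝ w u := by
  unfold OrS1 cmpSign
  simp only [sbtw_iff_not_btw, btw_coe_iff_of_abs_lt h₁ h₂ h₃,
    btw_coe_iff_of_abs_lt (u := w) (v := v) (w := u) (by rwa [abs_sub_comm])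
      (by rwa [abs_sub_comm]) (by rwa [abs_sub_comm])]
  grind

/-- The signed sum of `F` over all reorderings of the tuple `x`. -/
def altSum {α : Type*} {n : ℕ} (F : (Fin n → α) → ℝ) (x : Fin n → α) : ℝ :=
  ∑ σ : Equiv.Perm (Fin n), ((Equiv.Perm.sign σ : ℤ) : ℝ) * F (x ∘ σ)

section AltSum

variable {α : Type*} {n : ℕ}

theorem altSum_comp_perm (F : (Fin n → α) → ℝ) (x : Fin n → α) (e : Equiv.Perm (Fin n)) :
    altSum F (x ∘ e) = ((Equiv.Perm.sign e : ℤ) : ℝ) * altSum F x := by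
  unfold altSum
  rw [← Equiv.sum_comp (Equiv.mulLeft e⁻¹), Finset.mul_sum]
  refine Finset.sum_congr rfl fun σ _ => ?_
  have : (x ∘ e) ∘ (e⁻¹ * σ : Equiv.Perm (Fin n)) = x ∘ σ := by ext; simp
  simp only [Equiv.coe_mulLeft, this, Equiv.Perm.sign_mul, Equiv.Perm.sign_inv]
  push_cast
  ring

theorem altSum_comp_left (F : (Fin n → α) → ℝ) (x : Fin n → α) (e : Equiv.Perm (Fin n)) :
    altSum (fun y => F (y ∘ e)) x = ((Equiv.Perm.sign e : ℤ) : ℝ) * altSum F x := by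
  unfold altSum
  rw [← Equiv.sum_comp (Equiv.mulRight e⁻¹), Finset.mul_sum]
  refine Finset.sum_congr rfl fun σ _ => ?_
  have : (x ∘ (σ * e⁻¹ : Equiv.Perm (Fin n))) ∘ e = x ∘ σ := by ext; simp
  simp only [Equiv.coe_mulRight, this, Equiv.Perm.sign_mul, Equiv.Perm.sign_inv]
  push_cast
  ring

theorem altSum_succ (F : (Fin (n + 1) → α) → ℝ) (x : Fin (n + 1) → α) :
    altSum F x = ∑ p, (if p = 0 then 1 else -1) *
      altSum (fun y => F (Fin.cons (x p) y)) (fun i => x (Equiv.swap 0 p i.succ)) := by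
  unfold altSum
  rw [← Equiv.sum_comp Equiv.Perm.decomposeFin.symm, Fintype.sum_prod_type]
  refine Finset.sum_congr rfl fun p _ => ?_
  rw [Finset.mul_sum]
  refine Finset.sum_congr rfl fun σ _ => ?_
  have : x ∘ (Equiv.Perm.decomposeFin.symm (p, σ) : Equiv.Perm (Fin (n + 1))) =
      Fin.cons (x p) ((fun i => x (Equiv.swap 0 p i.succ)) ∘ σ) := by
    ext i
    refine Fin.cases ?_ (fun i => ?_) i <;> simp
  rw [this, Equiv.Perm.decomposeFin.symm_sign]
  split_ifs <;> simp

theorem altSum_mul_pair (b : α → α → ℝ) (G : (Fin n → α) → ℝ) (x : Fin (n + 2) → α) :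
    altSum (fun y => b (y 0) (y 1) * G (fun i => y i.succ.succ)) x =
      ∑ p : Fin (n + 2), ∑ q : Fin (n + 1),
        (if p = 0 then 1 else -1) * (if q = 0 then 1 else -1) *
          (b (x p) (x (Equiv.swap 0 p q.succ)) *
            altSum G (fun i => x (Equiv.swap 0 p (Equiv.swap 0 q i.succ).succ))) := by
  rw [altSum_succ]
  refine Finset.sum_congr rfl fun p _ => ?_
  rw [altSum_succ, Finset.mul_sum]
  refine Finset.sum_congr rfl fun q _ => ?_
  rw [mul_assoc]
  congr 2
  unfold altSum
  rw [Finset.mul_sum]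
  refine Finset.sum_congr rfl fun σ _ => ?_
  rw [mul_left_comm]
  rfl

theorem altSum_two (c : α → α → ℝ) (hc : ∀ i j, c j i = -c i j) (x : Fin 2 → α) :
    altSum (fun y => c (y 0) (y 1)) x = 2 * c (x 0) (x 1) := by
  simp only [altSum_succ, Fin.sum_univ_succ]
  simp [altSum, hc (x 0) (x 1)]
  ring

theorem altSum_four (a c : α → α → ℝ) (ha : ∀ i j, a j i = -a i j) (hc : ∀ i j, c j i = -c i j)
    (x : Fin 4 → α) :
    altSum (fun y => a (y 0) (y 1) * c (y 2) (y 3)) x =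
      4 * (a (x 0) (x 1) * c (x 2) (x 3) - a (x 0) (x 2) * c (x 1) (x 3)
        + a (x 0) (x 3) * c (x 1) (x 2) + a (x 1) (x 2) * c (x 0) (x 3)
        - a (x 1) (x 3) * c (x 0) (x 2) + a (x 2) (x 3) * c (x 0) (x 1)) := by
  refine (altSum_mul_pair a (fun y => c (y 0) (y 1)) x).trans ?_
  simp only [altSum_two c hc, Fin.sum_univ_succ]
  simp [Equiv.swap_apply_def, Fin.ext_iff]
  rw [ha (x 0) (x 1), ha (x 0) (x 2), ha (x 0) (x 3), ha (x 1) (x 2), ha (x 1) (x 3),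
    ha (x 2) (x 3), hc (x 0) (x 1), hc (x 0) (x 2), hc (x 1) (x 2)]
  ring

theorem altSum_six (a b c : Fin 6 → Fin 6 → ℝ) (ha : ∀ i j, a j i = -a i j)
    (hb : ∀ i j, b j i = -b i j) (hc : ∀ i j, c j i = -c i j)
    (ha₀ : ∀ j, a 0 j = 0) (ha₁ : ∀ i j : Fin 5, i < j → a i.succ j.succ = 1) :
    altSum (fun y => b (y 0) (y 1) * (a (y 2) (y 3) * c (y 4) (y 5))) id =
      8 * (minorPairing (fun i => b 0 i.succ) (fun i j => c i.succ j.succ) +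
        minorPairing (fun i => c 0 i.succ) (fun i j => b i.succ j.succ)) := by
  refine (altSum_mul_pair b (fun y => a (y 0) (y 1) * c (y 2) (y 3)) id).trans ?_
  have h₁₂ : a 1 2 = 1 := ha₁ 0 1 (by decide)
  have h₁₃ : a 1 3 = 1 := ha₁ 0 2 (by decide)
  have h₁₄ : a 1 4 = 1 := ha₁ 0 3 (by decide)
  have h₁₅ : a 1 5 = 1 := ha₁ 0 4 (by decide)
  have h₂₃ : a 2 3 = 1 := ha₁ 1 2 (by decide)
  have h₂₄ : a 2 4 = 1 := ha₁ 1 3 (by decide)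
  have h₂₅ : a 2 5 = 1 := ha₁ 1 4 (by decide)
  have h₃₄ : a 3 4 = 1 := ha₁ 2 3 (by decide)
  have h₃₅ : a 3 5 = 1 := ha₁ 2 4 (by decide)
  have h₄₅ : a 4 5 = 1 := ha₁ 3 4 (by decide)
  have ha₀' : ∀ j, a j 0 = 0 := fun j => by rw [ha, ha₀, neg_zero]
  simp only [altSum_four a c ha hc, Fin.sum_univ_succ]
  simp [Equiv.swap_apply_def, Fin.ext_iff, minorPairing, pf4, ha₀, ha₀', ha 1 2, ha 1 3, ha 1 4,
    h₁₂, h₁₃, h₁₄, h₁₅, h₂₃, h₂₄, h₂₅,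
    h₃₄, h₃₅, h₄₅]
  simp only [hb 0 1, hb 0 2, hb 0 3, hb 0 4, hb 0 5, hb 1 2, hb 1 3, hb 1 4, hb 1 5, hb 2 3, hb 2 4,
    hb 2 5, hb 3 4, hb 3 5, hb 4 5, hc 0 1, hc 0 2, hc 0 3, hc 0 4, hc 1 2, hc 1 3, hc 1 4]
  ring

theorem altSum_eq_zero_of_comp_swap (F : (Fin n → α) → ℝ) (x : Fin n → α) {u v : Fin n}
    (huv : u ≠ v) (hF : ∀ y, F (y ∘ Equiv.swap u v) = F y) : altSum F x = 0 := by
  have h := altSum_comp_left F x (Equiv.swap u v)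
  simp only [hF, Equiv.Perm.sign_swap huv] at h
  push_cast at h
  linarith

end AltSum

/-- The signed sum over all reorderings of `Fin 7` of the product of `b`, `a` and `c` along the
pairs of positions `(e 0, e 1)`, `(e 2, e 3)` and `(e 4, e 5)`. -/
def edgeSum (a b c : Fin 7 → Fin 7 → ℝ) (e : Fin 6 → Fin 7) : ℝ :=
  altSum (fun y => b (y (e 0)) (y (e 1)) * (a (y (e 2)) (y (e 3)) * c (y (e 4)) (y (e 5)))) id

theorem edgeSum_perm_comp (a b c : Fin 7 → Fin 7 → ℝ) (e : Fin 6 → Fin 7)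
    (π : Equiv.Perm (Fin 7)) :
    edgeSum a b c (π ∘ e) = ((Equiv.Perm.sign π : ℤ) : ℝ) * edgeSum a b c e :=
  altSum_comp_left (fun y : Fin 7 → Fin 7 =>
    b (y (e 0)) (y (e 1)) * (a (y (e 2)) (y (e 3)) * c (y (e 4)) (y (e 5)))) id π

theorem edgeSum_eq_zero (a b c : Fin 7 → Fin 7 → ℝ) {e : Fin 6 → Fin 7} {u v : Fin 7}
    (huv : u ≠ v) (he : ∀ i, e i ≠ u ∧ e i ≠ v) : edgeSum a b c e = 0 := by
  refine altSum_eq_zero_of_comp_swap _ _ huv fun y => ?_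
  simp only [Function.comp_apply, Equiv.swap_apply_of_ne_of_ne (he _).1 (he _).2]

/-- The positions of edge `x.1` of `{0, 1, 2}`, `x.2.1` of `{2, 3, 4}` and `x.2.2` of `{4, 5, 6}`,
with the edge of `{2, 3, 4}` first. -/
def triangleEdges (x : Fin 3 × Fin 3 × Fin 3) : Fin 6 → Fin 7 :=
  ![![2, 3, 4] x.2.1, ![2, 3, 4] (x.2.1 + 1), ![0, 1, 2] x.1, ![0, 1, 2] (x.1 + 1),
    ![4, 5, 6] x.2.2, ![4, 5, 6] (x.2.2 + 1)]

theorem triangleEdges_cases : ∀ x : Fin 3 × Fin 3 × Fin 3,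
    if (∀ i j, triangleEdges x i = triangleEdges x j → i = j) then
      ∃ l ∈ [[0], [0, 1, 2], [0, 2, 1], [0, 3, 4, 2, 1], [0, 4, 3, 2, 1], [0, 5, 6, 4, 3, 2, 1],
        [0, 6, 5, 4, 3, 2, 1]], Equiv.Perm.sign (List.formPerm l) = 1 ∧
          ∀ i, triangleEdges x i = List.formPerm l (![3, 4, 1, 2, 5, 6] i)
    else ∃ u v, u ≠ v ∧ ∀ i, triangleEdges x i ≠ u ∧ triangleEdges x i ≠ v := by
  decide +kernel

theorem edgeSum_triangleEdges (a b c : Fin 7 → Fin 7 → ℝ) (x : Fin 3 × Fin 3 × Fin 3) :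
    edgeSum a b c (triangleEdges x) =
      if (∀ i j, triangleEdges x i = triangleEdges x j → i = j) then
        edgeSum a b c ![3, 4, 1, 2, 5, 6] else 0 := by
  have h := triangleEdges_cases x
  split_ifs at h ⊢ with hx
  · obtain ⟨l, -, hl, he⟩ := h
    rw [show triangleEdges x = List.formPerm l ∘ ![3, 4, 1, 2, 5, 6] from funext he,
      edgeSum_perm_comp, hl]
    simp
  · obtain ⟨u, v, huv, he⟩ := h
    exact edgeSum_eq_zero a b c huv he

theorem sum_edgeSum_triangleEdges (a b c : Fin 7 → Fin 7 → ℝ) :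
    ∑ x, edgeSum a b c (triangleEdges x) = 7 * edgeSum a b c ![3, 4, 1, 2, 5, 6] := by
  simp only [edgeSum_triangleEdges]
  rw [← Finset.sum_filter, Finset.sum_const, nsmul_eq_mul]
  congr 1

theorem altSum_triangles (a b c : Fin 7 → Fin 7 → ℝ) :
    altSum (fun y => (a (y 0) (y 1) + a (y 1) (y 2) + a (y 2) (y 0)) *
      (b (y 2) (y 3) + b (y 3) (y 4) + b (y 4) (y 2)) *
      (c (y 4) (y 5) + c (y 5) (y 6) + c (y 6) (y 4))) id =
      7 * edgeSum a b c ![3, 4, 1, 2, 5, 6] := by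
  rw [← sum_edgeSum_triangleEdges]
  unfold edgeSum altSum
  rw [Finset.sum_comm]
  refine Finset.sum_congr rfl fun σ _ => ?_
  simp only [Fintype.sum_prod_type, Fin.sum_univ_three, triangleEdges]
  simp
  ring

theorem edgeSum_eq_altSum_six (a b c : Fin 7 → Fin 7 → ℝ) (ha : ∀ i j, a j i = -a i j)
    (hb : ∀ i j, b j i = -b i j) (hc : ∀ i j, c j i = -c i j)
    (ha₀ : ∀ j, a 0 j = 0) (hb₀ : ∀ j, b 0 j = 0) (hc₀ : ∀ j, c 0 j = 0) :
    edgeSum a b c ![3, 4, 1, 2, 5, 6] =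
      altSum (fun y => b (y 0).succ (y 1).succ *
        (a (y 2).succ (y 3).succ * c (y 4).succ (y 5).succ)) id := by
  have ha₀' : ∀ j, a j 0 = 0 := fun j => by rw [ha, ha₀, neg_zero]
  have hb₀' : ∀ j, b j 0 = 0 := fun j => by rw [hb, hb₀, neg_zero]
  have hc₀' : ∀ j, c j 0 = 0 := fun j => by rw [hc, hc₀, neg_zero]
  have hr := edgeSum_perm_comp a b c ![3, 4, 1, 2, 5, 6]
    (List.formPerm [1, 3] * List.formPerm [2, 4])
  have h1 : Equiv.Perm.sign (List.formPerm [1, 3] * List.formPerm [2, 4] :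
      Equiv.Perm (Fin 7)) = 1 := by decide +kernel
  have h2 : (List.formPerm [1, 3] * List.formPerm [2, 4] : Equiv.Perm (Fin 7)) ∘
      ![3, 4, 1, 2, 5, 6] = Fin.succ := by decide +kernel
  rw [h1, h2] at hr
  push_cast at hr
  rw [one_mul] at hr
  rw [← hr, edgeSum, altSum_succ, Fin.sum_univ_succ, Finset.sum_eq_zero, add_zero]
  · simp only [if_true, one_mul, id, Equiv.swap_self, Equiv.refl_apply, Fin.cons_succ]
    rfl
  · intro p _
    rw [mul_eq_zero]
    right
    unfold altSum
    refine Finset.sum_eq_zero fun σ _ => ?_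
    have hp : ((fun i : Fin 6 => id (Equiv.swap 0 p.succ i.succ)) ∘ σ) (σ.symm p) = 0 := by simp
    generalize σ.symm p = k at hp
    simp only [Fin.cons_succ]
    generalize (fun i : Fin 6 => id (Equiv.swap 0 p.succ i.succ)) ∘ σ = y at hp
    fin_cases k <;> simp at hp <;> simp [hp, ha₀, ha₀', hb₀, hb₀', hc₀, hc₀']

theorem cmpSign_antisymm {β : Type*} [LinearOrder β] {R : Type*} [Ring R] (x y : β) :
    cmpSign R y x = -cmpSign R x y := by
  unfold cmpSign
  grind

theorem abs_minorPairing_le {v : Fin 5 → ℤ} (hv : ∀ i, |v i| = 1) (c : Fin 5 → Fin 5 → ℤ) :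
    |minorPairing v c| ≤ minorNorm c := by
  have h : ∀ i x, |v i * x| = |x| := fun i x => by rw [abs_mul, hv, one_mul]
  unfold minorPairing minorNorm
  refine (abs_add_le _ _).trans ?_
  refine (add_le_add_left ((abs_sub _ _).trans (add_le_add_left ((abs_add_le _ _).trans
    (add_le_add_left (abs_sub _ _) _)) _)) _).trans ?_
  simp only [h, le_refl]

theorem abs_threshold (t : Fin 6) (σ : Equiv.Perm (Fin 5)) (i : Fin 5) :
    |threshold ℤ t σ i| = 1 := by
  unfold threshold
  split_ifs <;> simp

theorem abs_minorPairing_add_le (s t : Fin 6) (σ τ : Equiv.Perm (Fin 5)) :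
    |minorPairing (threshold ℝ s σ) (fun i j => cmpSign ℝ (τ i) (τ j)) +
      minorPairing (threshold ℝ t τ) (fun i j => cmpSign ℝ (σ i) (σ j))| ≤ 20 := by
  have key : |minorPairing (threshold ℤ s σ) (fun i j => cmpSign ℤ (τ i) (τ j)) +
      minorPairing (threshold ℤ t τ) (fun i j => cmpSign ℤ (σ i) (σ j))| ≤ 20 := by
    have h₁ := abs_minorPairing_le (abs_threshold s σ) (fun i j => cmpSign ℤ (τ i) (τ j))
    have h₂ := abs_minorPairing_le (abs_threshold t τ) (fun i j => cmpSign ℤ (σ i) (σ j))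
    have h₃ := abs_add_le (minorPairing (threshold ℤ s σ) (fun i j => cmpSign ℤ (τ i) (τ j)))
      (minorPairing (threshold ℤ t τ) (fun i j => cmpSign ℤ (σ i) (σ j)))
    rcases minorPairing_check σ with hσ | hσ
    · rcases minorPairing_check τ with hτ | hτ
      · linarith
      · rcases hτ σ with h | h
        · linarith
        · rw [add_comm]
          exact h t s
    · rcases hσ τ with h | h
      · linarith
      · exact h s t
  have hc : ∀ (π : Equiv.Perm (Fin 5)) i j,
      ((cmpSign ℤ (π i) (π j) : ℤ) : ℝ) = cmpSign ℝ (π i) (π j) := by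
    intro π i j
    unfold cmpSign
    split_ifs <;> simp
  have ht : ∀ (t : Fin 6) (π : Equiv.Perm (Fin 5)) i,
      ((threshold ℤ t π i : ℤ) : ℝ) = threshold ℝ t π i := by
    intro t π i
    unfold threshold
    split_ifs <;> simp
  have := (Int.cast_le (R := ℝ)).2 key
  simpa [minorPairing, pf4, hc, ht] using this

theorem exists_threshold_perm {β : Type*} [LinearOrder β] {f : Fin 6 → β}
    (hf : Function.Injective f) : ∃ (t : Fin 6) (σ : Equiv.Perm (Fin 5)),
      (fun i => cmpSign ℝ (f 0) (f i.succ)) = threshold ℝ t σ ∧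
      (fun i j => cmpSign ℝ (f i.succ) (f j.succ)) = fun i j => cmpSign ℝ (σ i) (σ j) := by
  set π : Equiv.Perm (Fin 6) := (Tuple.sort f).symm with hπ
  have hmono : StrictMono (f ∘ Tuple.sort f) :=
    (Tuple.monotone_sort f).strictMono_of_injective (hf.comp (Tuple.sort f).injective)
  have hlt : ∀ i j, f i < f j ↔ π i < π j := by
    intro i j
    rw [← hmono.lt_iff_lt]
    simp [hπ]
  have hex : ∀ i : Fin 5, ∃ k, (π 0).succAbove k = π i.succ := fun i =>
    Fin.exists_succAbove_eq (by simp)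
  choose g hg using hex
  have hginj : Function.Injective g := by
    intro i j hij
    have := hg i
    rw [hij, hg j] at this
    simpa using this.symm
  refine ⟨π 0, Equiv.ofBijective g (Finite.injective_iff_bijective.1 hginj), ?_, ?_⟩
  · funext i
    have h : f 0 < f i.succ ↔ π 0 ≤ (g i).castSucc := by
      rw [hlt, ← hg, Fin.lt_succAbove_iff_le_castSucc]
    have h' : f i.succ < f 0 ↔ ¬ π 0 ≤ (g i).castSucc := by
      rw [← h, not_lt]
      exact ⟨le_of_lt, fun h => lt_of_le_of_ne h (hf.ne (Fin.succ_ne_zero i))⟩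
    simp only [cmpSign, threshold, h, h', Equiv.ofBijective_apply]
    split_ifs <;> simp_all
  · funext i j
    simp only [cmpSign, hlt, ← hg, Equiv.ofBijective_apply, (Fin.strictMono_succAbove _).lt_iff_lt]

theorem exists_lift (φ : Fin 7 → S1) (k : Fin 7) :
    ∃ y : Fin 7 → ℝ, (∀ i, y k ≤ y i) ∧ (∀ i, y i < y k + 1) ∧ ∀ i, φ i = (y i : S1) := by
  obtain ⟨a, ha⟩ := QuotientAddGroup.mk_surjective (φ k)
  have hk : (AddCircle.equivIco 1 a (φ k) : ℝ) = a := by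
    rw [← ha]
    exact congrArg Subtype.val (AddCircle.equivIco_coe_eq (by simp))
  refine ⟨fun i => AddCircle.equivIco 1 a (φ i), fun i => ?_, fun i => ?_, fun i => ?_⟩
  · beta_reduce
    rw [hk]
    exact (AddCircle.equivIco 1 a (φ i)).2.1
  · beta_reduce
    rw [hk]
    exact (AddCircle.equivIco 1 a (φ i)).2.2
  · exact AddCircle.coe_equivIco.symm

theorem OrS1_of_lift {φ : Fin 7 → S1} {k : Fin 7} {y : Fin 7 → ℝ} (h₁ : ∀ i, y k ≤ y i)
    (h₂ : ∀ i, y i < y k + 1) (h₃ : ∀ i, φ i = (y i : S1)) (i j l : Fin 7) :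
    OrS1 (φ i) (φ j) (φ l) =
      cmpSign ℝ (y i) (y j) + cmpSign ℝ (y j) (y l) + cmpSign ℝ (y l) (y i) := by
  have h : ∀ i j, |y i - y j| < 1 := fun i j =>
    abs_lt.2 ⟨by linarith [h₁ i, h₂ j], by linarith [h₁ j, h₂ i]⟩
  rw [h₃, h₃, h₃, OrS1_coe (h _ _) (h _ _) (h _ _)]

theorem OrS1_cocycle (φ : Fin 7 → S1) (i j k : Fin 7) :
    OrS1 (φ i) (φ j) (φ k) =
      OrS1 (φ 0) (φ i) (φ j) + OrS1 (φ 0) (φ j) (φ k) + OrS1 (φ 0) (φ k) (φ i) := by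
  obtain ⟨y, h₁, h₂, h₃⟩ := exists_lift φ 0
  simp only [OrS1_of_lift h₁ h₂ h₃]
  rw [cmpSign_antisymm (y 0) (y i), cmpSign_antisymm (y 0) (y j), cmpSign_antisymm (y 0) (y k)]
  ring

theorem OrS1_antisymm (φ : Fin 7 → S1) (i j : Fin 7) :
    OrS1 (φ 0) (φ j) (φ i) = -OrS1 (φ 0) (φ i) (φ j) := by
  obtain ⟨y, h₁, h₂, h₃⟩ := exists_lift φ 0
  simp only [OrS1_of_lift h₁ h₂ h₃]
  rw [cmpSign_antisymm (y 0) (y i), cmpSign_antisymm (y 0) (y j), cmpSign_antisymm (y i) (y j)]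
  ring

theorem OrS1_self_left (φ : Fin 7 → S1) (i : Fin 7) : OrS1 (φ 0) (φ 0) (φ i) = 0 := by
  obtain ⟨y, h₁, h₂, h₃⟩ := exists_lift φ 0
  simp only [OrS1_of_lift h₁ h₂ h₃]
  rw [cmpSign_antisymm (y 0) (y i)]
  simp [cmpSign]

theorem OrS1_eq_average (φ : Fin 7 → S1) : ∃ f g : Fin 6 → ℝ ×ₗ ℝ,
    Function.Injective f ∧ Function.Injective g ∧ ∀ i j, OrS1 (φ 0) (φ i.succ) (φ j.succ) =
      (cmpSign ℝ (f i) (f j) + cmpSign ℝ (g i) (g j)) / 2 := by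
  obtain ⟨y, h₁, h₂, h₃⟩ := exists_lift φ 0
  refine ⟨fun i => toLex (y i.succ, (i : ℝ)),
    fun i => toLex (if y i.succ = y 0 then y 0 + 1 else y i.succ, -(i : ℝ)), ?_, ?_, ?_⟩
  · intro i j h
    have := congrArg (fun z => (ofLex z).2) h
    simpa [Fin.ext_iff] using this
  · intro i j h
    have := congrArg (fun z => (ofLex z).2) h
    simpa [Fin.ext_iff] using this
  · intro i j
    rw [OrS1_of_lift h₁ h₂ h₃]
    have hi₁ := h₁ i.succ
    have hj₁ := h₁ j.succ
    have hi₂ := h₂ i.succ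
    have hj₂ := h₂ j.succ
    simp only [cmpSign, Prod.Lex.lt_iff, ofLex_toLex, neg_lt_neg_iff]
    rcases lt_trichotomy (i : ℝ) (j : ℝ) with h | h | h
    · grind
    · have : i = j := by simpa [Fin.ext_iff] using h
      subst this
      grind
    · grind

/-- The signed sum over the perfect matchings of `Fin 6` into an edge of `b`, an edge of `c` and an
edge not containing `0`. -/
def matchingForm (b c : Fin 6 → Fin 6 → ℝ) : ℝ :=
  minorPairing (fun i => b 0 i.succ) (fun i j => c i.succ j.succ) +
    minorPairing (fun i => c 0 i.succ) (fun i j => b i.succ j.succ)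

theorem abs_matchingForm_cmpSign_le {β γ : Type*} [LinearOrder β] [LinearOrder γ] {f : Fin 6 → β}
    {g : Fin 6 → γ} (hf : Function.Injective f) (hg : Function.Injective g) :
    |matchingForm (fun i j => cmpSign ℝ (f i) (f j)) (fun i j => cmpSign ℝ (g i) (g j))| ≤ 20 := by
  obtain ⟨s, σ, h₁, h₂⟩ := exists_threshold_perm hf
  obtain ⟨t, τ, h₃, h₄⟩ := exists_threshold_perm hg
  unfold matchingForm
  rw [h₁, h₂, h₃, h₄]
  exact abs_minorPairing_add_le s t σ τ

theorem abs_matchingForm_OrS1_le (φ ψ : Fin 7 → S1) :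
    |matchingForm (fun i j => OrS1 (φ 0) (φ i.succ) (φ j.succ))
      (fun i j => OrS1 (ψ 0) (ψ i.succ) (ψ j.succ))| ≤ 20 := by
  obtain ⟨f₁, f₂, hf₁, hf₂, hf⟩ := OrS1_eq_average φ
  obtain ⟨g₁, g₂, hg₁, hg₂, hg⟩ := OrS1_eq_average ψ
  have e : ∀ b₁ b₂ c₁ c₂ : Fin 6 → Fin 6 → ℝ,
      matchingForm (fun i j => (b₁ i j + b₂ i j) / 2) (fun i j => (c₁ i j + c₂ i j) / 2) =
        (matchingForm b₁ c₁ + matchingForm b₁ c₂ + matchingForm b₂ c₁ + matchingForm b₂ c₂) / 4 := by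
    intro b₁ b₂ c₁ c₂
    simp only [matchingForm, minorPairing, pf4]
    ring
  simp only [hf, hg]
  rw [e (fun i j => cmpSign ℝ (f₁ i) (f₁ j)) _ (fun i j => cmpSign ℝ (g₁ i) (g₁ j))]
  have h₁ := abs_le.1 (abs_matchingForm_cmpSign_le hf₁ hg₁)
  have h₂ := abs_le.1 (abs_matchingForm_cmpSign_le hf₁ hg₂)
  have h₃ := abs_le.1 (abs_matchingForm_cmpSign_le hf₂ hg₁)
  have h₄ := abs_le.1 (abs_matchingForm_cmpSign_le hf₂ hg₂)
  rw [abs_le]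
  constructor <;> linarith

theorem Theta_eq_altSum (θ : Fin 7 → T3) : Theta θ = 1 / 5040 * altSum (fun y =>
    OrS1 (y 0).1 (y 1).1 (y 2).1 * OrS1 (y 2).2.1 (y 3).2.1 (y 4).2.1 *
      OrS1 (y 4).2.2 (y 5).2.2 (y 6).2.2) θ := by
  have h : ((Nat.factorial 7 : ℕ) : ℝ) = 5040 := by norm_num [Nat.factorial]
  unfold Theta
  rw [h]
  rfl

theorem abs_Theta_comp_perm (θ : Fin 7 → T3) (e : Equiv.Perm (Fin 7)) :
    |Theta (θ ∘ e)| = |Theta θ| := by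
  rw [Theta_eq_altSum, Theta_eq_altSum, altSum_comp_perm]
  rcases Int.units_eq_one_or (Equiv.Perm.sign e) with h | h <;> simp [h]

theorem Theta_eq_matchingForm (θ : Fin 7 → T3) (h₀ : (θ 1).1 = (θ 0).1)
    (h₁ : ∀ i j : Fin 5, i < j → OrS1 (θ 0).1 (θ i.succ.succ).1 (θ j.succ.succ).1 = 1) :
    Theta θ = 1 / 90 * matchingForm
      (fun i j => OrS1 (θ 0).2.1 (θ i.succ).2.1 (θ j.succ).2.1)
      (fun i j => OrS1 (θ 0).2.2 (θ i.succ).2.2 (θ j.succ).2.2) := by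
  set a : Fin 7 → Fin 7 → ℝ := fun i j => OrS1 (θ 0).1 (θ i).1 (θ j).1 with ha
  set b : Fin 7 → Fin 7 → ℝ := fun i j => OrS1 (θ 0).2.1 (θ i).2.1 (θ j).2.1 with hb
  set c : Fin 7 → Fin 7 → ℝ := fun i j => OrS1 (θ 0).2.2 (θ i).2.2 (θ j).2.2 with hc
  have ha' : ∀ i j, a j i = -a i j := OrS1_antisymm fun i => (θ i).1
  have hb' : ∀ i j, b j i = -b i j := OrS1_antisymm fun i => (θ i).2.1
  have hc' : ∀ i j, c j i = -c i j := OrS1_antisymm fun i => (θ i).2.2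
  have ha₀ : ∀ j, a 0 j = 0 := OrS1_self_left fun i => (θ i).1
  have hb₀ : ∀ j, b 0 j = 0 := OrS1_self_left fun i => (θ i).2.1
  have hc₀ : ∀ j, c 0 j = 0 := OrS1_self_left fun i => (θ i).2.2
  have hsum := altSum_triangles a b c
  rw [edgeSum_eq_altSum_six a b c ha' hb' hc' ha₀ hb₀ hc₀,
    altSum_six (fun i j => a i.succ j.succ) (fun i j => b i.succ j.succ)
      (fun i j => c i.succ j.succ) (fun _ _ => ha' _ _) (fun _ _ => hb' _ _) (fun _ _ => hc' _ _)
      (fun j => by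
        change OrS1 (θ 0).1 (θ 1).1 _ = 0
        rw [h₀]
        exact ha₀ j.succ) h₁] at hsum
  have hθ : Theta θ = 1 / 5040 * altSum (fun y => (a (y 0) (y 1) + a (y 1) (y 2) + a (y 2) (y 0)) *
      (b (y 2) (y 3) + b (y 3) (y 4) + b (y 4) (y 2)) *
      (c (y 4) (y 5) + c (y 5) (y 6) + c (y 6) (y 4))) id := by
    rw [Theta_eq_altSum]
    unfold altSum
    congr 1
    refine Finset.sum_congr rfl fun σ _ => ?_
    congr 1
    simp only [Function.comp_apply, id]
    rw [OrS1_cocycle (fun i => (θ i).1), OrS1_cocycle (fun i => (θ i).2.1),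
      OrS1_cocycle (fun i => (θ i).2.2)]
  rw [hθ, hsum, matchingForm]
  ring

/-- If the seven first coordinates take exactly 6 distinct values (necessarily with
multiplicities `2, 1, 1, 1, 1, 1`), then `|Θ(θ₀,…,θ₆)| ≤ 2/9`. -/
theorem abs_Theta_le_of_six_distinct (θ : Fin 7 → T3)
    (h : (Set.range fun j => (θ j).1).ncard = 6) :
    |Theta θ| ≤ 2 / 9 := by
  have hninj : ¬ Function.Injective fun j => (θ j).1 := by
    intro hinj
    rw [← Set.image_univ, Set.ncard_image_of_injective _ hinj, Set.ncard_univ] at h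
    simp at h
  simp only [Function.Injective, not_forall] at hninj
  obtain ⟨p, q, hpq, hne⟩ := hninj
  obtain ⟨y, h₁, h₂, h₃⟩ := exists_lift (fun j => (θ j).1) p
  have hyq : y q = y p := by
    have e : ((y q : ℝ) : S1) = y p := by rw [← h₃, ← h₃, hpq]
    have := (AddCircle.coe_eq_coe_iff_of_mem_Ico (p := (1 : ℝ)) (a := y p) ⟨h₁ q, h₂ q⟩
      ⟨h₁ p, h₂ p⟩).1 e
    exact this
  set e := Tuple.sort y with he
  have hmono : Monotone (y ∘ e) := Tuple.monotone_sort y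
  have hy₁ : y (e 1) = y p := by
    refine le_antisymm ?_ (h₁ _)
    by_cases hp : e.symm p = 0
    · have hq : e.symm q ≠ 0 := fun hq => hne (e.symm.injective (hp.trans hq.symm))
      have := hmono (Fin.one_le_of_ne_zero hq)
      simpa [hyq] using this
    · simpa using hmono (Fin.one_le_of_ne_zero hp)
  have hy₀ : y (e 0) = y p := le_antisymm (hy₁ ▸ hmono (Fin.zero_le 1)) (h₁ _)
  have hstrict : ∀ i j : Fin 6, i < j → y (e i.succ) < y (e j.succ) := by
    intro i j hij
    refine lt_of_le_of_ne (hmono (Fin.succ_le_succ_iff.2 hij.le)) fun hy => ?_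
    have hsub : (Set.range fun k => (θ k).1) ⊆
        ((Finset.univ.erase (0 : Fin 7)).erase j.succ).image (fun k => (θ (e k)).1) := by
      rintro _ ⟨k, rfl⟩
      obtain ⟨k, rfl⟩ := e.surjective k
      simp only [Finset.coe_image, Set.mem_image, Finset.mem_coe, Finset.mem_erase,
        Finset.mem_univ, and_true]
      by_cases hk : k = j.succ
      · refine ⟨i.succ, ⟨?_, Fin.succ_ne_zero i⟩, ?_⟩
        · simpa using hij.ne
        · subst hk
          exact (h₃ _).trans (hy ▸ (h₃ _).symm)
      · by_cases hk₀ : k = 0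
        · refine ⟨1, ⟨fun hj => ?_, by decide⟩, ?_⟩
          · have : j = 0 := Fin.succ_injective _ (hj.symm.trans Fin.succ_zero_eq_one.symm)
            subst this
            exact absurd hij (Fin.not_lt_zero i)
          · subst hk₀
            exact (h₃ _).trans ((hy₁.trans hy₀.symm) ▸ (h₃ _).symm)
        · exact ⟨k, ⟨hk, hk₀⟩, rfl⟩
    have hcard := Set.ncard_le_ncard hsub (Finset.finite_toSet _)
    rw [h, Set.ncard_coe_finset] at hcard
    have := hcard.trans Finset.card_image_le
    rw [Finset.card_erase_of_mem (by simp), Finset.card_erase_of_mem (by simp)] at this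
    simp at this
  rw [← abs_Theta_comp_perm θ e, Theta_eq_matchingForm]
  · rw [abs_mul]
    have := abs_matchingForm_OrS1_le (fun i => (θ (e i)).2.1) (fun i => (θ (e i)).2.2)
    rw [abs_of_pos (by norm_num)]
    simp only [Function.comp_apply]
    linarith
  · exact (h₃ _).trans ((hy₀.trans hy₁.symm) ▸ (h₃ _).symm)
  · intro i j hij
    have h0 : ∀ k : Fin 5, y (e 0) < y (e k.succ.succ) := fun k => by
      rw [hy₀, ← hy₁]
      exact hstrict 0 k.succ (Fin.succ_pos k)
    refine (OrS1_of_lift h₁ h₂ h₃ (e 0) (e i.succ.succ) (e j.succ.succ)).trans ?_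
    simp [cmpSign, h0, (h0 j).not_gt, hstrict _ _ (Fin.succ_lt_succ_iff.2 hij)]
end
end
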